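/- Let s be a weak composition and T an s-decreasing tree with tree ascents (a,b) and (c,d), a < c, and let Z and Q be the s-tree rotations of T along (a,b) and (c,d). Suppose (c,d) is a tree ascent of Z but (a,b) is not a tree ascent of Q. Then the closed interval [T, Z ∨ Q] in s-weak order consists exactly of five elements T, Z, Q, P, Z ∨ Q (its Hasse diagram is a pentagon), with exactly two maximal chains T ⋖ Z ⋖ Z ∨ Q and T ⋖ Q ⋖ P ⋖ Z ∨ Q, whose label sequences under the labeling λ assigning to each cover relation the smaller element of its associated tree ascent are (a, c) and (c, a, a) respectively. -/

import Mathlib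

open scoped Classical

/-- An `s`-decreasing tree with internal vertices `1,…,n` (the root is `n`), encoded by
recording, for each non-root internal vertex `v`, its parent `parent v` (an internal vertex
with a larger label, so that labels decrease away from the root) and the index `idx v` of
the child slot of `parent v` (among `0,…,s (parent v)`, left to right) containing `v`.
Distinct internal vertices occupy distinct child slots; all remaining slots are leaves. -/
structure SDecTree (n : ℕ) (s : ℕ → ℕ) where
  parent : ℕ → ℕ
  idx : ℕ → ℕ
  parent_gt : ∀ v, 1 ≤ v → v < n → v < parent v
  parent_le : ∀ v, 1 ≤ v → v < n → parent v ≤ n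
  idx_le : ∀ v, 1 ≤ v → v < n → idx v ≤ s (parent v)
  slot_inj : ∀ v w, 1 ≤ v → v < n → 1 ≤ w → w < n →
      parent v = parent w → idx v = idx w → v = w
  parent_out : ∀ v, v = 0 ∨ n ≤ v → parent v = 0
  idx_out : ∀ v, v = 0 ∨ n ≤ v → idx v = 0

namespace SDecTree

variable {n : ℕ} {s : ℕ → ℕ}

/-- `y` is a weak ancestor of `x`, i.e. `x` is a labeled vertex of the subtree `T^y`. -/
def Descend (T : SDecTree n s) (x y : ℕ) : Prop :=
  ∃ k, T.parent^[k] x = y ∧ ∀ m ≤ k, 1 ≤ T.parent^[m] x ∧ T.parent^[m] x ≤ n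

/-- `x` is a labeled vertex of the subtree `T^y_j` rooted at the `j`-th child of `y`. -/
def InSub (T : SDecTree n s) (y j x : ℕ) : Prop :=
  ∃ c, T.Descend x c ∧ T.parent c = y ∧ T.idx c = j

/-- `x` lies strictly left of `y` in the planar tree `T`. -/
def LeftOf (T : SDecTree n s) (x y : ℕ) : Prop :=
  ∃ z j₁ j₂, j₁ < j₂ ∧ T.InSub z j₁ x ∧ T.InSub z j₂ y

/-- The cardinality `#_T(y,x)` of the pair `(y,x)`: it is `j` if `x ∈ T^y_j`
(so `0` if `x ∈ T^y_0` and `s y` if `x ∈ T^y_{s y}`), `0` if `x` is left of `y`, and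
`s y` if `x` is right of `y`; it is `0` for out-of-range pairs. -/
noncomputable def card (T : SDecTree n s) (y x : ℕ) : ℕ :=
  if h : ∃ j, T.InSub y j x then h.choose
  else if 1 ≤ x ∧ x < y ∧ y ≤ n ∧ ¬ T.LeftOf x y then s y else 0

/-- `x` is a labeled vertex of `T^a ∖ 0`, i.e. of `T^a` with `T^a_0` replaced by a leaf. -/
def InSubMinus0 (T : SDecTree n s) (a x : ℕ) : Prop :=
  x = a ∨ ∃ j, 0 < j ∧ T.InSub a j x

/-- `(a,b)` is a tree ascent of `T`. -/
def TreeAscent (T : SDecTree n s) (a b : ℕ) : Prop :=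
  1 ≤ a ∧ a < b ∧ b ≤ n ∧
  (∃ i, i < s b ∧ T.InSub b i a) ∧
  (∀ e j, a < e → e < b → T.InSub e j a → j = s e) ∧
  (0 < s a → ∀ x, ¬ T.InSub a (s a) x)

end SDecTree

/-- A multi-inversion set (encoded by its multiplicity function) is transitive:
if `a < b < c` then `#(b,a) = 0` or `#(c,a) ≥ #(c,b)`. -/
def IsTransitiveInv (I : ℕ → ℕ → ℕ) : Prop :=
  ∀ a b c, a < b → b < c → I b a = 0 ∨ I c b ≤ I c a

/-- The transitive closure of a multi-inversion set: the smallest (by inclusion, i.e.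
pointwise on multiplicities) transitive multi-inversion set containing it. -/
noncomputable def tcInv (I : ℕ → ℕ → ℕ) : ℕ → ℕ → ℕ := fun y x =>
  sInf {m | ∃ J : ℕ → ℕ → ℕ, IsTransitiveInv J ∧ (∀ y' x', I y' x' ≤ J y' x') ∧ J y x = m}

/-- Add one copy of the inversion `(b,a)` to `I`, capping the multiplicity at `s b`. -/
def addInv (s : ℕ → ℕ) (I : ℕ → ℕ → ℕ) (b a : ℕ) : ℕ → ℕ → ℕ := fun y x =>
  if y = b ∧ x = a then min (I y x + 1) (s y) else I y x

namespace SDecTree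

variable {n : ℕ} {s : ℕ → ℕ}

/-- The `s`-weak order: `T ⪯ Z` iff `#_T(y,x) ≤ #_Z(y,x)` for all pairs. -/
def wle (T Z : SDecTree n s) : Prop := ∀ y x, T.card y x ≤ Z.card y x

/-- Strict `s`-weak order. -/
def wlt (T Z : SDecTree n s) : Prop := wle T Z ∧ ¬ wle Z T

/-- Cover relation in the `s`-weak order. -/
def wcov (T Z : SDecTree n s) : Prop := wlt T Z ∧ ∀ U, wlt T U → wlt U Z → False

/-- `W` is the join of `T` and `Z` in the `s`-weak order. -/
def IsJoin (T Z W : SDecTree n s) : Prop :=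
  wle T W ∧ wle Z W ∧ ∀ U, wle T U → wle Z U → wle W U

/-- `Z` is the `s`-tree rotation of `T` along the tree ascent `(a,b)`, i.e.
`inv Z = (inv T + (b,a))^tc`. -/
def IsRotation (T Z : SDecTree n s) (a b : ℕ) : Prop :=
  T.TreeAscent a b ∧
  ∀ y x, 1 ≤ x → x < y → y ≤ n → Z.card y x = tcInv (addInv s T.card b a) y x

/-- The set `A_T(a,b)` of inversions added by a rotation producing `Z`: the pairs `(f,e)`
with `#_Z(f,e) > #_T(f,e)`. -/
def Aset (T Z : SDecTree n s) : Set (ℕ × ℕ) :=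
  {p | T.card p.1 p.2 < Z.card p.1 p.2}

/-- The set `A_T(a,b)` described directly via the transitive closure. -/
def ARot (T : SDecTree n s) (a b : ℕ) : Set (ℕ × ℕ) :=
  {p | T.card p.1 p.2 < tcInv (addInv s T.card b a) p.1 p.2}

/-- The set `F_T(a,c)` (here `b` and `d` are the partners of `a` and `c` in the
respective tree ascents `(a,b)` and `(c,d)`): it is `{(d,e) : e ∈ T^a∖0}` if `b = c`
and `a ∈ T^c_0`, and empty otherwise. -/
def Fset (T : SDecTree n s) (a b c d : ℕ) : Set (ℕ × ℕ) :=
  {p | b = c ∧ T.InSub c 0 a ∧ p.1 = d ∧ T.InSubMinus0 a p.2}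

/-- `T` is an `s`-Tamari tree: `#_T(c,a) ≤ #_T(c,b)` whenever `a < b < c`. -/
def IsTamari (T : SDecTree n s) : Prop :=
  ∀ a b c, a < b → b < c → T.card c a ≤ T.card c b

/-- `(a,b)` is a Tamari tree ascent of `T`: `a` is a non-rightmost child of `b`. -/
def TamariAscent (T : SDecTree n s) (a b : ℕ) : Prop :=
  1 ≤ a ∧ a < n ∧ T.parent a = b ∧ T.card b a < s b

/-- `Z` is the `s`-Tamari rotation of `T` along the Tamari tree ascent `(a,b)`. -/
def IsTamRotation (T Z : SDecTree n s) (a b : ℕ) : Prop :=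
  T.TamariAscent a b ∧
  ∀ y x, 1 ≤ x → x < y → y ≤ n → Z.card y x = tcInv (addInv s T.card b a) y x

/-- Cover relation in the `s`-Tamari lattice. -/
def tamcov (T Z : SDecTree n s) : Prop :=
  IsTamari T ∧ IsTamari Z ∧ wlt T Z ∧ ∀ U, IsTamari U → wlt T U → wlt U Z → False

/-- `W` is the join of `T` and `Z` in the `s`-Tamari lattice. -/
def IsTamJoin (T Z W : SDecTree n s) : Prop :=
  IsTamari W ∧ wle T W ∧ wle Z W ∧ ∀ U, IsTamari U → wle T U → wle Z U → wle W U

/-- The open interval `(T,Z)` in the `s`-weak order. -/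
def OpenInterval (T Z : SDecTree n s) : Set (SDecTree n s) := {U | wlt T U ∧ wlt U Z}

/-- A set of trees forming a chain in the `s`-weak order. -/
def IsChainSet (C : Set (SDecTree n s)) : Prop :=
  C.Pairwise fun U V => wlt U V ∨ wlt V U

/-- The geometric realization of the order complex `Δ(T,Z)` of the open interval `(T,Z)`
in the `s`-weak order: the space of finitely supported probability vectors on the vertex
set whose support is a chain of the open interval. -/
def orderComplex (T Z : SDecTree n s) : Set (SDecTree n s → ℝ) :=
  {f | (∀ U, 0 ≤ f U) ∧ (Function.support f).Finite ∧
    Function.support f ⊆ OpenInterval T Z ∧ IsChainSet (Function.support f) ∧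
    ∑ᶠ U, f U = 1}

/-- The geometric realization of the order complex of the open interval `(T,Z)` in the
`s`-Tamari lattice. -/
def tamOrderComplex (T Z : SDecTree n s) : Set (SDecTree n s → ℝ) :=
  {f | (∀ U, 0 ≤ f U) ∧ (Function.support f).Finite ∧
    Function.support f ⊆ {U | IsTamari U ∧ wlt T U ∧ wlt U Z} ∧
    IsChainSet (Function.support f) ∧ ∑ᶠ U, f U = 1}

end SDecTree

/-- The list of labels of the consecutive cover relations along a saturated chain,
recorded as a list of poset elements. -/
def labelsOf {α : Type*} (lab : α → α → ℕ) (L : List α) : List ℕ :=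
  (L.zip L.tail).map fun p => lab p.1 p.2

namespace SDecTree

variable {n : ℕ} {s : ℕ → ℕ}

lemma desc_refl (T : SDecTree n s) {x : ℕ} (h1 : 1 ≤ x) (h2 : x ≤ n) : T.Descend x x :=
  ⟨0, rfl, fun m hm => by
    obtain rfl : m = 0 := by omega
    exact ⟨h1, h2⟩⟩

lemma desc_range (T : SDecTree n s) {x y : ℕ} (h : T.Descend x y) :
    1 ≤ x ∧ x ≤ n ∧ 1 ≤ y ∧ y ≤ n := by
  obtain ⟨k, hk, hm⟩ := h
  have h0 := hm 0 (by omega)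
  have h1 := hm k le_rfl
  rw [hk] at h1
  exact ⟨h0.1, h0.2, h1.1, h1.2⟩

lemma desc_cases (T : SDecTree n s) {x y : ℕ} (h : T.Descend x y) :
    x = y ∨ (1 ≤ x ∧ x < n ∧ T.Descend (T.parent x) y) := by
  have hr := T.desc_range h
  obtain ⟨k, hk, hm⟩ := h
  cases k with
  | zero => left; exact hk
  | succ k =>
    right
    have h1 := hm 1 (by omega)
    simp only [Function.iterate_one] at h1
    have hx : x < n := by
      by_contra hx
      have := T.parent_out x (Or.inr (by omega))
      omega
    refine ⟨hr.1, hx, k, ?_, ?_⟩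
    · rw [← Function.iterate_succ_apply]; exact hk
    · intro m hmk
      rw [← Function.iterate_succ_apply]
      exact hm _ (by omega)

lemma desc_head (T : SDecTree n s) {x y : ℕ} (h1 : 1 ≤ x) (h2 : x < n)
    (h : T.Descend (T.parent x) y) : T.Descend x y := by
  obtain ⟨k, hk, hm⟩ := h
  refine ⟨k + 1, by rw [Function.iterate_succ_apply]; exact hk, ?_⟩
  intro m hmk
  cases m with
  | zero => exact ⟨h1, h2.le⟩
  | succ m =>
    rw [Function.iterate_succ_apply]
    exact hm m (by omega)

lemma desc_step (T : SDecTree n s) {x : ℕ} (h1 : 1 ≤ x) (h2 : x < n) :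
    T.Descend x (T.parent x) := by
  have := T.parent_gt x h1 h2
  exact T.desc_head h1 h2 (T.desc_refl (by omega) (T.parent_le x h1 h2))

/-- Induction principle along the ancestors of a vertex. -/
lemma up_induction (T : SDecTree n s) {p : ℕ → Prop}
    (h : ∀ x, 1 ≤ x → x ≤ n → (x < n → p (T.parent x)) → p x) :
    ∀ x, 1 ≤ x → x ≤ n → p x := by
  intro x
  induction hk : n - x using Nat.strong_induction_on generalizing x with
  | _ k ih =>
    intro h1 h2
    refine h x h1 h2 fun hx => ?_
    have := T.parent_gt x h1 hx
    have := T.parent_le x h1 hx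
    exact ih (n - T.parent x) (by omega) _ rfl (by omega) (by omega)

lemma desc_le (T : SDecTree n s) {x y : ℕ} (h : T.Descend x y) : x ≤ y := by
  have hr := T.desc_range h
  revert h
  refine T.up_induction (p := fun x => T.Descend x y → x ≤ y) ?_ x hr.1 hr.2.1
  intro x h1 h2 ih h
  rcases T.desc_cases h with rfl | ⟨_, h3, h4⟩
  · exact le_rfl
  · have := T.parent_gt x h1 h3
    have := ih h3 h4
    omega

lemma desc_trans (T : SDecTree n s) {x y z : ℕ} (h : T.Descend x y) (h' : T.Descend y z) :
    T.Descend x z := by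
  have hr := T.desc_range h
  revert h
  refine T.up_induction (p := fun x => T.Descend x y → T.Descend x z) ?_ x hr.1 hr.2.1
  intro x h1 h2 ih h
  rcases T.desc_cases h with rfl | ⟨_, h3, h4⟩
  · exact h'
  · exact T.desc_head h1 h3 (ih h3 h4)

lemma desc_chain (T : SDecTree n s) {x y z : ℕ} (h : T.Descend x y) (h' : T.Descend x z)
    (hyz : y ≤ z) : T.Descend y z := by
  have hr := T.desc_range h
  revert h h'
  refine T.up_induction
    (p := fun x => T.Descend x y → T.Descend x z → T.Descend y z) ?_ x hr.1 hr.2.1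
  intro x h1 h2 ih h h'
  rcases T.desc_cases h with rfl | ⟨_, h3, h4⟩
  · exact h'
  · rcases T.desc_cases h' with rfl | ⟨_, h5, h6⟩
    · have := T.desc_le h
      obtain rfl : x = y := by omega
      exact h'
    · exact ih h3 h4 h6

lemma desc_root (T : SDecTree n s) {x : ℕ} (h1 : 1 ≤ x) (h2 : x ≤ n) : T.Descend x n := by
  refine T.up_induction (p := fun x => T.Descend x n) ?_ x h1 h2
  intro x h1 h2 ih
  rcases h2.lt_or_eq with h | rfl
  · exact T.desc_head h1 h (ih h)
  · exact T.desc_refl h1 le_rfl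

lemma inSub_zero (T : SDecTree n s) {j x : ℕ} (h : T.InSub 0 j x) : j = 0 := by
  obtain ⟨c, h1, h2, h3⟩ := h
  have hr := T.desc_range h1
  rw [← h3]
  apply T.idx_out
  right
  by_contra hc
  have := T.parent_gt c hr.2.2.1 (by omega)
  omega

lemma inSub_child (T : SDecTree n s) {y j x : ℕ} (hy : 1 ≤ y) (h : T.InSub y j x) :
    ∃ c, T.Descend x c ∧ T.parent c = y ∧ T.idx c = j ∧ 1 ≤ c ∧ c < n ∧ x ≤ c ∧ c < y ∧ y ≤ n
      ∧ 1 ≤ x ∧ j ≤ s y := by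
  obtain ⟨c, h1, h2, h3⟩ := h
  have hr := T.desc_range h1
  have hc : c < n := by
    by_contra hc
    have := T.parent_out c (Or.inr (by omega))
    omega
  have h4 := T.parent_gt c hr.2.2.1 hc
  have h5 := T.parent_le c hr.2.2.1 hc
  have h6 := T.idx_le c hr.2.2.1 hc
  rw [h2] at h4 h5 h6
  rw [h3] at h6
  exact ⟨c, h1, h2, h3, hr.2.2.1, hc, T.desc_le h1, h4, h5, hr.1, h6⟩

lemma inSub_desc (T : SDecTree n s) {y j x : ℕ} (hy : 1 ≤ y) (h : T.InSub y j x) :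
    T.Descend x y := by
  obtain ⟨c, h1, h2, h3, h4, h5, -⟩ := T.inSub_child hy h
  have := T.desc_step h4 h5
  rw [h2] at this
  exact T.desc_trans h1 this

lemma inSub_of_desc (T : SDecTree n s) {x y : ℕ} (h : T.Descend x y) (hne : x < y) :
    ∃ j, T.InSub y j x := by
  have hr := T.desc_range h
  revert h hne
  refine T.up_induction
    (p := fun x => T.Descend x y → x < y → ∃ j, T.InSub y j x) ?_ x hr.1 hr.2.1
  intro x h1 h2 ih h hne
  rcases T.desc_cases h with rfl | ⟨_, h3, h4⟩
  · omega
  · rcases (T.desc_le h4).lt_or_eq with h5 | h5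
    · obtain ⟨j, c, hc1, hc2⟩ := ih h3 h4 h5
      exact ⟨j, c, T.desc_head h1 h3 hc1, hc2⟩
    · exact ⟨T.idx x, x, T.desc_refl h1 h2, h5, rfl⟩

lemma inSub_trans (T : SDecTree n s) {w x y j : ℕ} (h : T.Descend w x) (h' : T.InSub y j x) :
    T.InSub y j w := by
  obtain ⟨c, hc, hc'⟩ := h'
  exact ⟨c, T.desc_trans h hc, hc'⟩

lemma inSub_unique (T : SDecTree n s) {x y i j : ℕ} (h : T.InSub y i x) (h' : T.InSub y j x) :
    i = j := by
  rcases Nat.eq_zero_or_pos y with rfl | hy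
  · rw [T.inSub_zero h, T.inSub_zero h']
  obtain ⟨c, h1, h2, h3, h4, h5, h6, h7, -⟩ := T.inSub_child hy h
  obtain ⟨c', g1, g2, g3, g4, g5, g6, g7, -⟩ := T.inSub_child hy h'
  have key : ∀ u v, T.Descend x u → T.Descend x v → T.parent u = y → v < y → 1 ≤ u → u < n →
      u ≤ v → u = v := by
    intro u v hu hv hp hvy hu1 hun huv
    rcases T.desc_cases (T.desc_chain hu hv huv) with h | ⟨_, _, h⟩
    · exact h
    · have := T.desc_le h
      omega
  have : c = c' := by
    rcases le_total c c' with h | h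
    · exact key c c' h1 g1 h2 g7 h4 h5 h
    · exact (key c' c g1 h1 g2 h7 g4 g5 h).symm
  rw [← h3, ← g3, this]

/-- `x` lies in child slot `j` of `z`, moving up. -/
lemma inSub_up (T : SDecTree n s) {x y z j : ℕ} (h : T.InSub z j x) (hz : 1 ≤ z)
    (h' : T.Descend x y) (hyz : y < z) : T.InSub z j y := by
  have h1 := T.desc_chain h' (T.inSub_desc hz h) hyz.le
  obtain ⟨i, hi⟩ := T.inSub_of_desc h1 hyz
  have := T.inSub_unique h (T.inSub_trans h' hi)
  rwa [this]

lemma inSub_common (T : SDecTree n s) {x y z j : ℕ} (hz : 1 ≤ z) (h : T.InSub z j x)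
    (h' : T.InSub z j y) : ∃ c, c < z ∧ T.Descend x c ∧ T.Descend y c := by
  obtain ⟨c, h1, h2, h3, h4, h5, h6, h7, -⟩ := T.inSub_child hz h
  obtain ⟨c', g1, g2, g3, g4, g5, g6, g7, -⟩ := T.inSub_child hz h'
  have := T.slot_inj c c' h4 h5 g4 g5 (by omega) (by omega)
  subst this
  exact ⟨c, h7, h1, g1⟩

lemma leftOf_spec (T : SDecTree n s) {x y : ℕ} (h : T.LeftOf x y) :
    ∃ z i j, i < j ∧ T.InSub z i x ∧ T.InSub z j y ∧ 1 ≤ z ∧ x < z ∧ y < z ∧ z ≤ n ∧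
      T.Descend x z ∧ T.Descend y z ∧ 1 ≤ x ∧ 1 ≤ y := by
  obtain ⟨z, i, j, hij, hx, hy⟩ := h
  have hz : 1 ≤ z := by
    by_contra hz
    obtain rfl : z = 0 := by omega
    have := T.inSub_zero hx
    have := T.inSub_zero hy
    omega
  obtain ⟨c, h1, h2, h3, h4, h5, h6, h7, h8, h9, -⟩ := T.inSub_child hz hx
  obtain ⟨c', g1, g2, g3, g4, g5, g6, g7, g8, g9, -⟩ := T.inSub_child hz hy
  exact ⟨z, i, j, hij, hx, hy, hz, by omega, by omega, h8, T.inSub_desc hz hx,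
    T.inSub_desc hz hy, h9, g9⟩

lemma leftOf_trans (T : SDecTree n s) {x y w : ℕ} (h : T.LeftOf x y) (h' : T.LeftOf y w) :
    T.LeftOf x w := by
  obtain ⟨z, i, j, hij, hx, hy, hz, hxz, hyz, hzn, dx, dy, -⟩ := T.leftOf_spec h
  obtain ⟨z', i', j', hij', hx', hy', hz', hxz', hyz', hzn', dx', dy', -⟩ := T.leftOf_spec h'
  rcases lt_trichotomy z z' with hlt | rfl | hlt
  · exact ⟨z', i', j', hij', T.inSub_trans dx (T.inSub_up hx' hz' dy hlt), hy'⟩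
  · have := T.inSub_unique hy hx'
    exact ⟨z, i, j', by omega, hx, hy'⟩
  · exact ⟨z, i, j, hij, hx, T.inSub_trans dy' (T.inSub_up hy hz dx' hlt)⟩

lemma leftOf_irrefl (T : SDecTree n s) {x : ℕ} (h : T.LeftOf x x) : False := by
  obtain ⟨z, i, j, hij, hx, hy⟩ := h
  have := T.inSub_unique hx hy
  omega

lemma leftOf_desc_left (T : SDecTree n s) {x y w : ℕ} (h : T.LeftOf x y) (hw : T.Descend w x) :
    T.LeftOf w y := by
  obtain ⟨z, i, j, hij, hx, hy⟩ := h
  exact ⟨z, i, j, hij, T.inSub_trans hw hx, hy⟩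

lemma leftOf_desc_right (T : SDecTree n s) {x y w : ℕ} (h : T.LeftOf x y)
    (hw : T.Descend w y) : T.LeftOf x w := by
  obtain ⟨z, i, j, hij, hx, hy⟩ := h
  exact ⟨z, i, j, hij, hx, T.inSub_trans hw hy⟩

lemma leftOf_not_desc (T : SDecTree n s) {x y : ℕ} (h : T.LeftOf x y) :
    ¬ T.Descend x y ∧ ¬ T.Descend y x := by
  refine ⟨fun hd => ?_, fun hd => ?_⟩
  · exact T.leftOf_irrefl (T.leftOf_desc_right h hd)
  · exact T.leftOf_irrefl (T.leftOf_desc_left h hd)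

lemma trichotomy (T : SDecTree n s) {x y : ℕ} (h1 : 1 ≤ x) (h2 : x < y) (h3 : y ≤ n) :
    T.Descend x y ∨ T.LeftOf x y ∨ T.LeftOf y x := by
  by_cases hd : T.Descend x y
  · exact Or.inl hd
  right
  have hex : ∃ z, T.Descend x z ∧ T.Descend y z :=
    ⟨n, T.desc_root h1 (by omega), T.desc_root (by omega) h3⟩
  obtain ⟨hx, hy⟩ := Nat.find_spec hex
  set z := Nat.find hex with hzdef
  have hyz : y < z := by
    rcases (T.desc_le hy).lt_or_eq with h | h
    · exact h
    · rw [← h] at hx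
      exact absurd hx hd
  obtain ⟨i, hi⟩ := T.inSub_of_desc hx (by omega)
  obtain ⟨j, hj⟩ := T.inSub_of_desc hy hyz
  rcases lt_trichotomy i j with h | rfl | h
  · exact Or.inl ⟨z, i, j, h, hi, hj⟩
  · obtain ⟨c, hc, hcx, hcy⟩ := T.inSub_common (by omega) hi hj
    exact absurd ⟨hcx, hcy⟩ (Nat.find_min hex hc)
  · exact Or.inr ⟨z, j, i, h, hj, hi⟩

lemma card_of_inSub (T : SDecTree n s) {y j x : ℕ} (h : T.InSub y j x) : T.card y x = j := by
  have hex : ∃ j, T.InSub y j x := ⟨j, h⟩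
  unfold card
  rw [dif_pos hex]
  exact T.inSub_unique hex.choose_spec h

lemma card_of_left (T : SDecTree n s) {y x : ℕ} (h : T.LeftOf x y) : T.card y x = 0 := by
  have hne : ¬ ∃ j, T.InSub y j x := by
    rintro ⟨j, hj⟩
    obtain ⟨z, i, k, -, -, -, -, -, -, -, -, -, -, hy⟩ := T.leftOf_spec h
    exact (T.leftOf_not_desc h).1 (T.inSub_desc hy hj)
  unfold card
  rw [dif_neg hne, if_neg]
  tauto

lemma card_of_right (T : SDecTree n s) {y x : ℕ} (hxy : x < y) (h : T.LeftOf y x) :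
    T.card y x = s y := by
  obtain ⟨z, i, k, -, -, -, -, hyz, -, hzn, -, -, hx, hy⟩ := T.leftOf_spec h
  have hne : ¬ ∃ j, T.InSub y j x := by
    rintro ⟨j, hj⟩
    exact (T.leftOf_not_desc h).2 (T.inSub_desc (by omega) hj)
  unfold card
  rw [dif_neg hne, if_pos]
  exact ⟨by omega, hxy, by omega, fun h' => T.leftOf_irrefl (T.leftOf_trans h h')⟩

lemma card_out (T : SDecTree n s) {y x : ℕ} (h : ¬ (1 ≤ x ∧ x < y ∧ y ≤ n)) :
    T.card y x = 0 := by
  by_cases hex : ∃ j, T.InSub y j x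
  · obtain ⟨j, hj⟩ := hex
    rcases Nat.eq_zero_or_pos y with rfl | hy
    · rw [T.card_of_inSub hj, T.inSub_zero hj]
    · obtain ⟨c, h1, h2, h3, h4, h5, h6, h7, h8, h9, -⟩ := T.inSub_child hy hj
      omega
  · unfold card
    rw [dif_neg hex, if_neg]
    tauto

lemma card_desc (T : SDecTree n s) {x y z : ℕ} (h : T.Descend x y) (hz : y < z) :
    T.card z x = T.card z y := by
  have hr := T.desc_range h
  have hxy := T.desc_le h
  by_cases hzn : z ≤ n
  · rcases T.trichotomy hr.2.2.1 hz hzn with hd | hd | hd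
    · obtain ⟨j, hj⟩ := T.inSub_of_desc hd hz
      rw [T.card_of_inSub hj, T.card_of_inSub (T.inSub_trans h hj)]
    · rw [T.card_of_left hd, T.card_of_left (T.leftOf_desc_left hd h)]
    · rw [T.card_of_right hz hd, T.card_of_right (by omega) (T.leftOf_desc_right hd h)]
  · rw [T.card_out (by omega), T.card_out (by omega)]

lemma card_le (T : SDecTree n s) (y x : ℕ) : T.card y x ≤ s y := by
  by_cases h : 1 ≤ x ∧ x < y ∧ y ≤ n
  · rcases T.trichotomy h.1 h.2.1 h.2.2 with hd | hd | hd
    · obtain ⟨j, hj⟩ := T.inSub_of_desc hd h.2.1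
      rw [T.card_of_inSub hj]
      obtain ⟨c, h1, h2, h3, h4, h5, h6, h7, h8, h9, h10⟩ := T.inSub_child (by omega) hj
      exact h10
    · rw [T.card_of_left hd]; omega
    · rw [T.card_of_right h.2.1 hd]
  · rw [T.card_out h]; omega

lemma card_mono (T : SDecTree n s) {x y z : ℕ} (h : T.LeftOf x y) (hx : x < z) (hy : y < z) :
    T.card z x ≤ T.card z y := by
  obtain ⟨-, -, -, -, -, -, -, -, -, -, -, -, hx1, hy1⟩ := T.leftOf_spec h
  by_cases hzn : z ≤ n
  · rcases T.trichotomy hx1 hx hzn with hd | hd | hd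
    · rcases T.trichotomy hy1 hy hzn with he | he | he
      · obtain ⟨i, hi⟩ := T.inSub_of_desc hd hx
        obtain ⟨j, hj⟩ := T.inSub_of_desc he hy
        rw [T.card_of_inSub hi, T.card_of_inSub hj]
        by_contra hij
        exact T.leftOf_irrefl (T.leftOf_trans h ⟨z, j, i, by omega, hj, hi⟩)
      · exact (T.leftOf_irrefl (T.leftOf_trans h (T.leftOf_desc_right he hd))).elim
      · rw [T.card_of_right hy he]
        exact T.card_le _ _
    · rw [T.card_of_left hd]; omega
    · rw [T.card_of_right hy (T.leftOf_trans hd h)]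
      exact T.card_le _ _
  · rw [T.card_out (by omega)]; omega

end SDecTree

/-- Tree inversion sets: bounded, transitive and planar multiplicity functions. -/
structure IsInv (n : ℕ) (s : ℕ → ℕ) (I : ℕ → ℕ → ℕ) : Prop where
  out : ∀ y x, ¬ (1 ≤ x ∧ x < y ∧ y ≤ n) → I y x = 0
  le : ∀ y x, I y x ≤ s y
  tr : ∀ x y z, x < y → y < z → I y x = 0 ∨ I z y ≤ I z x
  pl : ∀ x y z, x < y → y < z → I y x = s y ∨ I z x ≤ I z y

/-- `y` is a strict ancestor of `x`, read off from the inversion set. -/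
def Anc (n : ℕ) (I : ℕ → ℕ → ℕ) (x y : ℕ) : Prop :=
  1 ≤ x ∧ x < y ∧ y ≤ n ∧ ∀ z, y < z → I z x = I z y

namespace SDecTree

variable {n : ℕ} {s : ℕ → ℕ}

lemma card_isInv (T : SDecTree n s) : IsInv n s T.card where
  out := fun y x h => T.card_out h
  le := T.card_le
  tr := by
    intro x y z hxy hyz
    by_cases hr : 1 ≤ x ∧ y ≤ n
    · rcases T.trichotomy hr.1 hxy hr.2 with hd | hd | hd
      · right; exact (T.card_desc hd hyz).ge
      · left; exact T.card_of_left hd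
      · right; exact T.card_mono hd hyz (by omega)
    · left; exact T.card_out (by omega)
  pl := by
    intro x y z hxy hyz
    by_cases hr : 1 ≤ x ∧ y ≤ n
    · rcases T.trichotomy hr.1 hxy hr.2 with hd | hd | hd
      · right; exact (T.card_desc hd hyz).le
      · right; exact T.card_mono hd (by omega) hyz
      · left; exact T.card_of_right hxy hd
    · right; rw [T.card_out (by omega)]; omega

lemma anc_iff (T : SDecTree n s) {x y : ℕ} :
    Anc n T.card x y ↔ T.Descend x y ∧ x < y := by
  constructor
  · rintro ⟨h1, h2, h3, h4⟩
    refine ⟨?_, h2⟩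
    rcases T.trichotomy h1 h2 h3 with hd | hd | hd
    · exact hd
    all_goals
      obtain ⟨z, i, j, hij, hi, hj, h5, h6, h7, -⟩ := T.leftOf_spec hd
      have := h4 z (by assumption)
      rw [T.card_of_inSub hi, T.card_of_inSub hj] at this
      omega
  · rintro ⟨h1, h2⟩
    have hr := T.desc_range h1
    exact ⟨hr.1, h2, hr.2.2.2, fun z hz => T.card_desc h1 hz⟩

lemma inSub_iff (T : SDecTree n s) {x y j : ℕ} (hy : 1 ≤ y) :
    T.InSub y j x ↔ Anc n T.card x y ∧ T.card y x = j := by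
  rw [anc_iff]
  constructor
  · intro h
    obtain ⟨c, h1, h2, h3, h4, h5, h6, h7, h8, h9, h10⟩ := T.inSub_child hy h
    exact ⟨⟨T.inSub_desc hy h, by omega⟩, T.card_of_inSub h⟩
  · rintro ⟨⟨h1, h2⟩, h3⟩
    obtain ⟨i, hi⟩ := T.inSub_of_desc h1 h2
    rw [T.card_of_inSub hi] at h3
    rwa [← h3]

lemma eq_of_card_eq {T U : SDecTree n s} (h : T.card = U.card) : T = U := by
  have key : ∀ T U : SDecTree n s, T.card = U.card → ∀ x, 1 ≤ x → x < n →
      U.parent x ≤ T.parent x := by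
    intro T U h x h1 h2
    have h3 : Anc n T.card x (T.parent x) :=
      T.anc_iff.2 ⟨T.desc_step h1 h2, T.parent_gt x h1 h2⟩
    rw [h] at h3
    obtain ⟨h4, h5⟩ := U.anc_iff.1 h3
    rcases U.desc_cases h4 with h6 | ⟨_, _, h6⟩
    · omega
    · exact U.desc_le h6
  have hp : ∀ x, T.parent x = U.parent x := by
    intro x
    by_cases hx : x = 0 ∨ n ≤ x
    · rw [T.parent_out x hx, U.parent_out x hx]
    · exact le_antisymm (key U T h.symm x (by omega) (by omega))
        (key T U h x (by omega) (by omega))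
  have hi : ∀ x, T.idx x = U.idx x := by
    intro x
    by_cases hx : x = 0 ∨ n ≤ x
    · rw [T.idx_out x hx, U.idx_out x hx]
    · have h1 : T.InSub (T.parent x) (T.idx x) x :=
        ⟨x, T.desc_refl (by omega) (by omega), rfl, rfl⟩
      have h2 : U.InSub (U.parent x) (U.idx x) x :=
        ⟨x, U.desc_refl (by omega) (by omega), rfl, rfl⟩
      rw [← T.card_of_inSub h1, ← U.card_of_inSub h2, h, hp]
  cases T
  cases U
  simp only [mk.injEq]
  exact ⟨funext hp, funext hi⟩

end SDecTree

section Inv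

variable {n : ℕ} {s : ℕ → ℕ} {I : ℕ → ℕ → ℕ}

lemma anc_trans {x y z : ℕ} (h : Anc n I x y) (h' : Anc n I y z) : Anc n I x z := by
  obtain ⟨h1, h2, h3, h4⟩ := h
  obtain ⟨g1, g2, g3, g4⟩ := h'
  refine ⟨h1, by omega, g3, fun u hu => ?_⟩
  rw [h4 u (by omega), g4 u hu]

lemma anc_chain {x y z : ℕ} (h : Anc n I x y) (h' : Anc n I x z) (hyz : y < z) :
    Anc n I y z := by
  obtain ⟨h1, h2, h3, h4⟩ := h
  obtain ⟨g1, g2, g3, g4⟩ := h'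
  refine ⟨by omega, hyz, g3, fun u hu => ?_⟩
  rw [← h4 u (by omega), g4 u hu]

/-- Two incomparable vertices branch off at a common ancestor. -/
lemma IsInv.branch (hI : IsInv n s I) {x y : ℕ} (h1 : 1 ≤ x) (h2 : x < y) (h3 : y ≤ n)
    (h : ¬ Anc n I x y) : ∃ u, y < u ∧ Anc n I x u ∧ Anc n I y u ∧ I u x ≠ I u y := by
  have hex : ∃ z, y < z ∧ I z x ≠ I z y := by
    by_contra hcon
    push Not at hcon
    exact h ⟨h1, h2, h3, hcon⟩
  have hbd : ∀ z, I z x ≠ I z y → z ≤ n := by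
    intro z hz
    by_contra hzn
    rw [hI.out z x (by omega), hI.out z y (by omega)] at hz
    exact hz rfl
  obtain ⟨z0, hz0, hz0'⟩ := hex
  set P : ℕ → Prop := fun z => y < z ∧ I z x ≠ I z y with hP
  have hspec : P (Nat.findGreatest P n) :=
    Nat.findGreatest_spec (P := P) (hbd z0 hz0') ⟨hz0, hz0'⟩
  set u := Nat.findGreatest P n with hu
  have hmax : ∀ v, u < v → I v x = I v y := by
    intro v hv
    by_contra hne
    exact Nat.findGreatest_is_greatest hv (hbd v hne) ⟨by have := hspec.1; omega, hne⟩
  obtain ⟨hyu, hne⟩ := hspec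
  have hun := hbd u hne
  have key : ∀ v, u < v → I v y = I v u := by
    intro v hv
    by_contra hc
    have e := hmax v hv
    have t1 := hI.tr x u v (by omega) hv
    have t2 := hI.tr y u v (by omega) hv
    have p1 := hI.pl x u v (by omega) hv
    have p2 := hI.pl y u v (by omega) hv
    omega
  exact ⟨u, hyu, ⟨h1, by omega, hun, fun v hv => by rw [hmax v hv, key v hv]⟩,
    ⟨by omega, hyu, hun, key⟩, hne⟩

/-- Every tree inversion set comes from a tree. -/
lemma IsInv.exists_tree (hI : IsInv n s I) : ∃ T : SDecTree n s, T.card = I := by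
  have hroot : ∀ x, 1 ≤ x → x < n → Anc n I x n := fun x h1 h2 =>
    ⟨h1, h2, le_rfl, fun z hz => by rw [hI.out z x (by omega), hI.out z n (by omega)]⟩
  have hmem : ∀ x, 1 ≤ x → x < n → Anc n I x (sInf {y | Anc n I x y}) := fun x h1 h2 =>
    Nat.sInf_mem (s := {y | Anc n I x y}) ⟨n, hroot x h1 h2⟩
  have hle : ∀ x y, Anc n I x y → sInf {y | Anc n I x y} ≤ y := fun x y h =>
    Nat.sInf_le (s := {y | Anc n I x y}) h
  set p : ℕ → ℕ := fun x => sInf {y | Anc n I x y} with hp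
  have hinj : ∀ v w, 1 ≤ v → v < n → 1 ≤ w → w < n → p v = p w → I (p v) v = I (p w) w →
      ¬ v < w := by
    intro v w hv1 hv2 hw1 hw2 hpe hie hvw
    have av : Anc n I v (p v) := hmem v hv1 hv2
    have aw : Anc n I w (p w) := hmem w hw1 hw2
    have hn : ¬ Anc n I v w := fun h => by
      have : p v ≤ w := hle v w h
      have := aw.2.1
      omega
    obtain ⟨u, hu, a1, a2, hne⟩ := hI.branch hv1 hvw hw2.le hn
    have h1 : p v ≤ u := hle v u a1
    rcases h1.lt_or_eq with h | h
    · apply hne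
      rw [av.2.2.2 u h, aw.2.2.2 u (by omega), hpe]
    · rw [← hpe, h] at hie
      exact hne hie
  let T : SDecTree n s :=
    { parent := fun x => if 1 ≤ x ∧ x < n then p x else 0
      idx := fun x => if 1 ≤ x ∧ x < n then I (p x) x else 0
      parent_gt := fun v h1 h2 => by
        rw [if_pos ⟨h1, h2⟩]; exact (hmem v h1 h2).2.1
      parent_le := fun v h1 h2 => by
        rw [if_pos ⟨h1, h2⟩]; exact (hmem v h1 h2).2.2.1
      idx_le := fun v h1 h2 => by
        rw [if_pos ⟨h1, h2⟩, if_pos ⟨h1, h2⟩]; exact hI.le _ _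
      slot_inj := fun v w hv1 hv2 hw1 hw2 e1 e2 => by
        rw [if_pos ⟨hv1, hv2⟩, if_pos ⟨hw1, hw2⟩] at e1 e2
        have := hinj v w hv1 hv2 hw1 hw2 e1 e2
        have := hinj w v hw1 hw2 hv1 hv2 e1.symm e2.symm
        omega
      parent_out := fun v h => by rw [if_neg (by omega)]
      idx_out := fun v h => by rw [if_neg (by omega)] }
  have hpar : ∀ x, 1 ≤ x → x < n → T.parent x = p x := fun x h1 h2 => if_pos ⟨h1, h2⟩
  have hidx : ∀ x, 1 ≤ x → x < n → T.idx x = I (p x) x := fun x h1 h2 => if_pos ⟨h1, h2⟩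
  have hdesc : ∀ x c, T.Descend x c → x = c ∨ Anc n I x c := by
    intro x c h
    have hr := T.desc_range h
    revert h
    refine T.up_induction
      (p := fun x => T.Descend x c → x = c ∨ Anc n I x c) ?_ x hr.1 hr.2.1
    intro x h1 h2 ih h
    rcases T.desc_cases h with rfl | ⟨_, h3, h4⟩
    · exact Or.inl rfl
    · right
      have ax : Anc n I x (T.parent x) := by rw [hpar x h1 h3]; exact hmem x h1 h3
      rcases ih h3 h4 with h5 | h5
      · rwa [← h5]
      · exact anc_trans ax h5
  have hsub : ∀ y j x, 1 ≤ y → T.InSub y j x → I y x = j := by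
    intro y j x hy h
    obtain ⟨c, h1, h2, h3, h4, h5, h6, h7, -⟩ := T.inSub_child hy h
    rw [hpar c h4 h5] at h2
    rw [hidx c h4 h5, h2] at h3
    rcases hdesc x c h1 with rfl | h8
    · exact h3
    · rw [h8.2.2.2 y h7, h3]
  refine ⟨T, ?_⟩
  funext y x
  by_cases hr : 1 ≤ x ∧ x < y ∧ y ≤ n
  · obtain ⟨h1, h2, h3⟩ := hr
    rcases T.trichotomy h1 h2 h3 with hd | hd | hd
    · obtain ⟨j, hj⟩ := T.inSub_of_desc hd h2
      rw [T.card_of_inSub hj, hsub y j x (by omega) hj]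
    · rw [T.card_of_left hd]
      obtain ⟨z, i, j, hij, hi, hj, h5, h6, h7, -⟩ := T.leftOf_spec hd
      have e1 := hsub z i x h5 hi
      have e2 := hsub z j y h5 hj
      have := hI.tr x y z h2 h7
      omega
    · rw [T.card_of_right h2 hd]
      obtain ⟨z, i, j, hij, hi, hj, h5, h6, h7, -⟩ := T.leftOf_spec hd
      have e1 := hsub z i y h5 hi
      have e2 := hsub z j x h5 hj
      have := hI.pl x y z h2 h6
      omega
  · rw [T.card_out hr, hI.out y x hr]

/-- Tree ascents, read off from the inversion set. -/
def Asc (n : ℕ) (s : ℕ → ℕ) (I : ℕ → ℕ → ℕ) (a b : ℕ) : Prop :=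
  Anc n I a b ∧ I b a < s b ∧ (∀ e, a < e → e < b → Anc n I a e → I e a = s e) ∧
  (0 < s a → ∀ x, Anc n I x a → I a x ≠ s a)

/-- The vertices of `T^a ∖ 0`. -/
def ES (n : ℕ) (I : ℕ → ℕ → ℕ) (a x : ℕ) : Prop := x = a ∨ (Anc n I x a ∧ 0 < I a x)

open scoped Classical in
/-- The inversion set of the rotation along `(a,b)`. -/
noncomputable def rot (n : ℕ) (I : ℕ → ℕ → ℕ) (a b : ℕ) : ℕ → ℕ → ℕ := fun y x =>
  if y = b ∧ ES n I a x then I y x + 1 else I y x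

lemma SDecTree.treeAscent_iff (T : SDecTree n s) {a b : ℕ} :
    T.TreeAscent a b ↔ Asc n s T.card a b := by
  constructor
  · rintro ⟨h1, h2, h3, ⟨i, hi, h4⟩, h5, h6⟩
    rw [T.inSub_iff (by omega)] at h4
    refine ⟨h4.1, by omega, fun e he1 he2 ha => ?_, fun hs x hx he => ?_⟩
    · exact h5 e _ he1 he2 ((T.inSub_iff (by omega)).2 ⟨ha, rfl⟩)
    · exact h6 hs x ((T.inSub_iff (by omega)).2 ⟨hx, he⟩)
  · rintro ⟨h1, h2, h3, h4⟩
    refine ⟨h1.1, h1.2.1, h1.2.2.1, ⟨_, h2, (T.inSub_iff (by have := h1.2.1; omega)).2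
      ⟨h1, rfl⟩⟩, fun e j he1 he2 hs => ?_, fun hs x hx => ?_⟩
    · rw [T.inSub_iff (by omega)] at hs
      rw [← hs.2]
      exact h3 e he1 he2 hs.1
    · rw [T.inSub_iff h1.1] at hx
      exact h4 hs x hx.1 hx.2

lemma rot_ne {a b y : ℕ} (h : y ≠ b) (x : ℕ) : rot n I a b y x = I y x := by
  simp [rot, h]

lemma rot_mem {a b x : ℕ} (h : ES n I a x) : rot n I a b b x = I b x + 1 := by
  simp [rot, h]

lemma rot_not_mem {a x : ℕ} (h : ¬ ES n I a x) (b y : ℕ) : rot n I a b y x = I y x := by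
  simp [rot, h]

lemma le_rot (a b y x : ℕ) : I y x ≤ rot n I a b y x := by
  unfold rot
  split_ifs <;> omega

lemma ES.le {a x : ℕ} (h : ES n I a x) : x ≤ a := by
  rcases h with rfl | h
  · exact le_rfl
  · exact h.1.2.1.le

lemma ES.eq {a x z : ℕ} (h : ES n I a x) (hz : a < z) : I z x = I z a := by
  rcases h with rfl | h
  · rfl
  · exact h.1.2.2.2 z hz

lemma ES.one_le {a x : ℕ} (h : ES n I a x) (ha : 1 ≤ a) : 1 ≤ x := by
  rcases h with rfl | h
  · exact ha
  · exact h.1.1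

lemma Asc.mem_of (hI : IsInv n s I) {a b x : ℕ} (h : Asc n s I a b) (hx : x < a)
    (h0 : 0 < I a x) (hb : I b x = I b a) : Anc n I x a := by
  obtain ⟨⟨h1, h2, h3, h4⟩, h5, h6, h7⟩ := h
  have hx1 : 1 ≤ x := by
    by_contra hc
    rw [hI.out a x (by omega)] at h0
    omega
  by_contra hn
  obtain ⟨u, hu, a1, a2, hne⟩ := hI.branch hx1 hx (by omega) hn
  have t := hI.tr x a u hx hu
  rcases lt_trichotomy u b with hub | rfl | hub
  · have := h6 u hu hub a2
    have := hI.le u x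
    omega
  · exact hne hb
  · have := h4 u hub
    have := hI.pl x b u (by omega) hub
    omega

lemma Asc.isInv_rot (hI : IsInv n s I) {a b : ℕ} (h : Asc n s I a b) :
    IsInv n s (rot n I a b) := by
  have hmem := fun x => Asc.mem_of hI h (x := x)
  obtain ⟨⟨h1, h2, h3, h4⟩, h5, h6, h7⟩ := h
  have hle : ∀ y x, rot n I a b y x ≤ s y := by
    intro y x
    by_cases hE : y = b ∧ ES n I a x
    · obtain ⟨rfl, hE⟩ := hE
      rw [rot_mem hE, hE.eq h2]
      omega
    · have : rot n I a b y x = I y x := by simp [rot, hE]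
      rw [this]
      exact hI.le y x
  refine ⟨fun y x hr => ?_, hle, fun x y z hxy hyz => ?_, fun x y z hxy hyz => ?_⟩
  · have : rot n I a b y x = I y x := by
      unfold rot
      rw [if_neg]
      rintro ⟨rfl, hE⟩
      have := hE.le
      have := hE.one_le h1
      omega
    rw [this]
    exact hI.out y x hr
  · by_cases hz : z = b
    · subst hz
      rw [rot_ne (by omega)]
      by_cases hy0 : I y x = 0
      · exact Or.inl hy0
      right
      have t := (hI.tr x y z hxy hyz).resolve_left hy0
      by_cases hyE : ES n I a y
      · have hxE : I z x = I z y → ES n I a x := by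
          intro he
          rw [hyE.eq h2] at he
          right
          have h0 : 0 < I a x := by
            rcases hyE with rfl | hyE
            · omega
            · have := hI.tr x y a hxy hyE.1.2.1
              have := hyE.2
              omega
          have hxa : x < a := by have := hyE.le; omega
          exact ⟨hmem x hxa h0 he, h0⟩
        rw [rot_mem hyE]
        rcases t.lt_or_eq with ht | ht
        · have := le_rot (n := n) (I := I) a z z x
          omega
        · rw [rot_mem (hxE ht.symm)]
          omega
      · rw [rot_not_mem hyE]
        have := le_rot (n := n) (I := I) a z z x
        omega
    · rw [rot_ne hz, rot_ne hz]
      by_cases hE : y = b ∧ ES n I a x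
      · obtain ⟨rfl, hE⟩ := hE
        right
        rw [hE.eq (by omega), h4 z hyz]
      · have : rot n I a b y x = I y x := by simp [rot, hE]
        rw [this]
        exact hI.tr x y z hxy hyz
  · by_cases hys : I y x = s y
    · left
      have := le_rot (n := n) (I := I) a b y x
      have := hle y x
      omega
    have t := (hI.pl x y z hxy hyz).resolve_left hys
    right
    by_cases hz : z = b
    · subst hz
      by_cases hxE : ES n I a x
      · have hyE : I z x = I z y → ES n I a y := by
          intro he
          rw [hxE.eq h2] at he
          rcases lt_trichotomy y a with hya | rfl | hya
          · right
            have hx' : Anc n I x a ∧ 0 < I a x := by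
              rcases hxE with rfl | hxE
              · omega
              · exact hxE
            have := hI.pl x y a hxy hya
            have h0 : 0 < I a y := by omega
            exact ⟨hmem y hya h0 he.symm, h0⟩
          · exact Or.inl rfl
          · exfalso
            have hxa : I y x = I y a := hxE.eq hya
            by_cases hA : Anc n I a y
            · have := h6 y hya hyz hA
              omega
            · obtain ⟨u, hu, a1, a2, hne⟩ := hI.branch h1 hya (by omega) hA
              have p1 := hI.pl a y u hya hu
              rcases lt_trichotomy u z with huz | rfl | huz
              · have := h6 u (by omega) huz a1
                have := hI.le u y
                omega
              · exact hne he
              · have := h4 u huz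
                have := hI.pl y z u hyz huz
                omega
        rw [rot_mem hxE]
        rcases t.lt_or_eq with ht | ht
        · have := le_rot (n := n) (I := I) a z z y
          omega
        · rw [rot_mem (hyE ht)]
          omega
      · rw [rot_not_mem hxE]
        have := le_rot (n := n) (I := I) a z z y
        omega
    · rw [rot_ne hz, rot_ne hz]
      exact t

lemma IsInv.transitive (hI : IsInv n s I) : IsTransitiveInv I := hI.tr

lemma Asc.rot_le (hI : IsInv n s I) {a b : ℕ} (h : Asc n s I a b) {J : ℕ → ℕ → ℕ}
    (hJ : IsTransitiveInv J) (hle : ∀ y x, I y x ≤ J y x) (hba : I b a + 1 ≤ J b a) (y x : ℕ) :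
    rot n I a b y x ≤ J y x := by
  by_cases hE : y = b ∧ ES n I a x
  · obtain ⟨rfl, hE⟩ := hE
    rw [rot_mem hE, hE.eq h.1.2.1]
    rcases hE with rfl | ⟨hE, h0⟩
    · exact hba
    · have := hJ x a y hE.2.1 h.1.2.1
      have := hle a x
      omega
  · have : rot n I a b y x = I y x := by simp [rot, hE]
    rw [this]
    exact hle y x

lemma Asc.tcInv_eq (hI : IsInv n s I) {a b : ℕ} (h : Asc n s I a b) :
    tcInv (addInv s I b a) = rot n I a b := by
  funext y x
  have hba : addInv s I b a b a = I b a + 1 := by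
    have := h.2.1
    simp only [addInv, and_self, if_true]
    omega
  have hge : ∀ y x, I y x ≤ addInv s I b a y x := by
    intro y x
    have := hI.le y x
    unfold addInv
    split_ifs <;> omega
  unfold tcInv
  apply le_antisymm
  · apply Nat.sInf_le
    refine ⟨_, (h.isInv_rot hI).tr, fun y' x' => ?_, rfl⟩
    by_cases hc : y' = b ∧ x' = a
    · obtain ⟨rfl, rfl⟩ := hc
      rw [hba, rot_mem (Or.inl rfl)]
    · rw [addInv, if_neg hc]
      exact le_rot _ _ _ _
  · apply le_csInf
    · exact ⟨_, _, (fun p q r _ _ => Or.inr le_rfl : IsTransitiveInv fun y _ => s y),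
        fun y' x' => by
          have := hI.le y' x'
          unfold addInv
          split_ifs <;> omega, rfl⟩
    · rintro m ⟨J, hJ, hle, rfl⟩
      exact h.rot_le hI hJ (fun y x => (hge y x).trans (hle y x)) (hba ▸ hle b a) y x

lemma SDecTree.isRotation_iff (T Z : SDecTree n s) {a b : ℕ} :
    SDecTree.IsRotation T Z a b ↔ Asc n s T.card a b ∧ Z.card = rot n T.card a b := by
  unfold SDecTree.IsRotation
  rw [T.treeAscent_iff]
  refine and_congr_right fun h => ?_
  rw [h.tcInv_eq T.card_isInv]
  constructor
  · intro hz
    funext y x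
    by_cases hr : 1 ≤ x ∧ x < y ∧ y ≤ n
    · exact hz y x hr.1 hr.2.1 hr.2.2
    · rw [Z.card_out hr, (h.isInv_rot T.card_isInv).out y x hr]
  · intro hz y x _ _ _
    rw [hz]

end Inv

section Pentagon

variable {n : ℕ} {s : ℕ → ℕ} {I : ℕ → ℕ → ℕ}

/-- A moved and an unmoved vertex below `c` do not become aligned after rotating at `(c,d)`. -/
lemma Asc.sep (hI : IsInv n s I) {c d p q : ℕ} (h : Asc n s I c d) (hp : p < c) (hq : q < c)
    (hpE : ES n I c p) (hqE : ¬ ES n I c q) (hc : I c p = I c q)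
    (hd : rot n I c d d p = rot n I c d d q) : False := by
  rw [rot_mem hpE, rot_not_mem hqE, hpE.eq h.1.2.1] at hd
  have h1 := hI.pl q c d hq h.1.2.1
  rcases hpE with rfl | ⟨hA, h0⟩
  · omega
  · exact h.2.2.2 (by have := hI.le c p; omega) p hA (by omega)

lemma Asc.forced (hI : IsInv n s I) {a b c d : ℕ} (hab : Asc n s I a b) (hcd : Asc n s I c d)
    (hac : a < c) (hbc : ¬ (b = c ∧ I c a = 0)) : Asc n s (rot n I c d) a b := by
  have hsep := fun p q => hcd.sep hI (p := p) (q := q)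
  have hJ := hcd.isInv_rot hI
  obtain ⟨hAab, h5, h6, h7⟩ := hab
  obtain ⟨hAcd, g5, g6, g7⟩ := hcd
  have hcd := hAcd.2.1
  have habl := hAab.2.1
  -- if `a` is moved then `b ≤ c`
  have hmv : ES n I c a → b ≤ c := by
    rintro (h | ⟨hA, h0⟩)
    · omega
    · by_contra hlt
      have := h6 c hac (by omega) hA
      exact g7 (by omega) a hA this
  refine ⟨⟨hAab.1, hAab.2.1, hAab.2.2.1, fun z hz => ?_⟩, ?_, fun e he1 he2 hA => ?_,
    fun hs x hx hxe => ?_⟩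
  · have hzI := hAab.2.2.2 z hz
    by_cases hzd : z = d
    · subst hzd
      have hiff : ES n I c a ↔ ES n I c b := by
        constructor
        · intro h
          rcases (hmv h).lt_or_eq with hlt | rfl
          · rcases h with h | ⟨hA, h0⟩
            · omega
            · right
              refine ⟨anc_chain hAab hA hlt, ?_⟩
              rw [← hAab.2.2.2 c hlt]
              exact h0
          · exact Or.inl rfl
        · rintro (rfl | ⟨hA, h0⟩)
          · exact Or.inr ⟨hAab, by omega⟩
          · right
            refine ⟨anc_trans hAab hA, ?_⟩
            rw [hAab.2.2.2 c hA.2.1]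
            exact h0
      simp only [rot, hiff, hzI]
    · rw [rot_ne hzd, rot_ne hzd, hzI]
  · by_cases hE : b = d ∧ ES n I c a
    · have := hmv hE.2
      omega
    · have : rot n I c d b a = I b a := by simp [rot, hE]
      omega
  · have hJe := hJ.le e a
    have hle := le_rot (n := n) (I := I) c d e a
    by_cases hAI : Anc n I a e
    · have := h6 e he1 he2 hAI
      omega
    · obtain ⟨u, hu, a1, a2, hne⟩ := hI.branch hAab.1 he1 (by have := hAab.2.2.1; omega) hAI
      have hu' := hA.2.2.2 u hu
      have hud : u = d := by
        by_contra hud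
        rw [rot_ne hud, rot_ne hud] at hu'
        exact hne hu'
      subst hud
      by_cases haE : ES n I c a
      · have hbc' := hmv haE
        have heE : ¬ ES n I c e := by
          intro heE
          rw [rot_mem haE, rot_mem heE] at hu'
          omega
        have hc := hA.2.2.2 c (by omega)
        rw [rot_ne (by omega), rot_ne (by omega)] at hc
        exact (hsep a e hac (by omega) haE heE hc hu').elim
      · have heE : ES n I c e := by
          by_contra heE
          rw [rot_not_mem haE, rot_not_mem heE] at hu'
          omega
        rcases heE.le.lt_or_eq with hlt | rfl
        · have hc := hA.2.2.2 c (by omega)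
          rw [rot_ne (by omega), rot_ne (by omega)] at hc
          exact (hsep e a hlt hac heE haE hc.symm hu'.symm).elim
        · rw [rot_mem heE, rot_not_mem haE] at hu'
          have := hI.pl a e u he1 hu
          omega
  · rw [rot_ne (by omega)] at hxe
    have hAI : ¬ Anc n I x a := fun h => h7 hs x h hxe
    obtain ⟨u, hu, a1, a2, hne⟩ := hI.branch hx.1 hx.2.1 hx.2.2.1 hAI
    have hu' := hx.2.2.2 u hu
    have hud : u = d := by
      by_contra hud
      rw [rot_ne hud, rot_ne hud] at hu'
      exact hne hu'
    subst hud
    have hxa := hx.2.1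
    have hc := hx.2.2.2 c hac
    rw [rot_ne (by omega), rot_ne (by omega)] at hc
    by_cases haE : ES n I c a
    · have hxE : ¬ ES n I c x := by
        intro hxE
        rw [rot_mem haE, rot_mem hxE] at hu'
        omega
      exact hsep a x hac (by omega) haE hxE hc.symm hu'.symm
    · have hxE : ES n I c x := by
        by_contra hxE
        rw [rot_not_mem haE, rot_not_mem hxE] at hu'
        omega
      exact hsep x a (by omega) hac hxE haE hc hu'

/-- In the pentagon situation, rotating `a` upwards still requires two steps. -/
lemma Asc.two_le (hI : IsInv n s I) {a c d : ℕ} (hac : Asc n s I a c)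
    (h0 : I c a = 0) (hZ : Asc n s (rot n I a c) c d) : 2 ≤ s c := by
  have h1 := hac.2.1
  by_contra h2
  refine hZ.2.2.2 (by omega) a ⟨hac.1.1, hac.1.2.1, hac.1.2.2.1, fun z hz => ?_⟩ ?_
  · rw [rot_ne (by omega), rot_ne (by omega)]
    exact hac.1.2.2.2 z hz
  · rw [rot_mem (Or.inl rfl)]
    omega

/-- The vertices of `E_a` are not in `E_c`. -/
lemma ES.disj {a c x : ℕ} (hac : a < c) (h0 : I c a = 0) (h : ES n I a x) : ¬ ES n I c x := by
  intro h'
  have := h.eq hac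
  have := h.le
  rcases h' with rfl | ⟨-, h'⟩ <;> omega

lemma Asc.ancQ (hI : IsInv n s I) {a c d x : ℕ} (hac : Asc n s I a c) (hcd : Asc n s I c d)
    (h0 : I c a = 0) (hxa : x < a) : Anc n (rot n I c d) x a ↔ Anc n I x a := by
  have h1 := hac.1.2.1
  have h2 := hcd.1.2.1
  have haE : ¬ ES n I c a := ES.disj h1 h0 (Or.inl rfl)
  constructor
  · intro hx
    have hc := hx.2.2.2 c h1
    rw [rot_ne (by omega), rot_ne (by omega)] at hc
    have hxE : ¬ ES n I c x := by
      rintro (h | ⟨-, h⟩) <;> omega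
    refine ⟨hx.1, hx.2.1, hx.2.2.1, fun z hz => ?_⟩
    have := hx.2.2.2 z hz
    rwa [rot_not_mem hxE, rot_not_mem haE] at this
  · intro hx
    have hc := hx.2.2.2 c h1
    have hxE : ¬ ES n I c x := by
      rintro (h | ⟨-, h⟩) <;> omega
    refine ⟨hx.1, hx.2.1, hx.2.2.1, fun z hz => ?_⟩
    rw [rot_not_mem hxE, rot_not_mem haE]
    exact hx.2.2.2 z hz

lemma Asc.ascQ (hI : IsInv n s I) {a c d : ℕ} (hac : Asc n s I a c) (hcd : Asc n s I c d)
    (h0 : I c a = 0) : Asc n s (rot n I c d) a d := by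
  have h1 := hac.1.2.1
  have h2 := hcd.1.2.1
  have haE : ¬ ES n I c a := ES.disj h1 h0 (Or.inl rfl)
  have had := anc_trans hac.1 hcd.1
  refine ⟨⟨had.1, had.2.1, had.2.2.1, fun z hz => ?_⟩, ?_, fun e he1 he2 hA => ?_,
    fun hs x hx hxe => ?_⟩
  · rw [rot_ne (by omega), rot_ne (by omega)]
    exact had.2.2.2 z hz
  · rw [rot_not_mem haE, hac.1.2.2.2 d h2]
    exact hcd.2.1
  · rw [rot_not_mem haE]
    by_cases heE : ES n I c e
    · exfalso
      rcases heE with rfl | ⟨hE, hE0⟩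
      · have := hA.2.2.2 d h2
        rw [rot_not_mem haE, rot_mem (Or.inl rfl), hac.1.2.2.2 d h2] at this
        omega
      · have := hA.2.2.2 c hE.2.1
        rw [rot_ne (by omega), rot_ne (by omega)] at this
        omega
    · have hA' : Anc n I a e := ⟨hA.1, hA.2.1, hA.2.2.1, fun z hz => by
        have := hA.2.2.2 z hz
        rwa [rot_not_mem haE, rot_not_mem heE] at this⟩
      rcases lt_trichotomy e c with h | rfl | h
      · exact hac.2.2.1 e he1 h hA'
      · exact absurd (Or.inl rfl) heE
      · rw [hac.1.2.2.2 e h]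
        exact hcd.2.2.1 e h he2 (anc_chain hac.1 hA' h)
  · rw [rot_ne (by omega)] at hxe
    exact hac.2.2.2 hs x ((hac.ancQ hI hcd h0 hx.2.1).1 hx) hxe

lemma Asc.ES_Q (hI : IsInv n s I) {a c d x : ℕ} (hac : Asc n s I a c) (hcd : Asc n s I c d)
    (h0 : I c a = 0) : ES n (rot n I c d) a x ↔ ES n I a x := by
  have h1 := hac.1.2.1
  have h2 := hcd.1.2.1
  unfold ES
  rw [rot_ne (by omega : a ≠ d)]
  by_cases hx : x < a
  · rw [hac.ancQ hI hcd h0 hx]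
  · have e1 : ¬ Anc n (rot n I c d) x a := fun h => hx h.2.1
    have e2 : ¬ Anc n I x a := fun h => hx h.2.1
    simp [e1, e2]

open scoped Classical in
/-- Inversion sets between `T` and `W` in the pentagon: `x`, `y`, `v` record whether
the blocks `(c, E_a)`, `(d, E_c)`, `(d, E_a)` are added. -/
noncomputable def blk (n : ℕ) (I : ℕ → ℕ → ℕ) (a c d : ℕ) (x y v : Prop) : ℕ → ℕ → ℕ :=
  fun p q => I p q + (if p = c ∧ ES n I a q ∧ x then 1 else 0) +
    (if p = d ∧ ES n I c q ∧ y then 1 else 0) + (if p = d ∧ ES n I a q ∧ v then 1 else 0)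

lemma blk_T {a c d : ℕ} : I = blk n I a c d False False False := by
  funext p q
  simp [blk]

lemma blk_Z {a c d : ℕ} : rot n I a c = blk n I a c d True False False := by
  funext p q
  simp only [blk, rot]
  split_ifs <;> simp_all

lemma blk_Q {a c d : ℕ} : rot n I c d = blk n I a c d False True False := by
  funext p q
  simp only [blk, rot]
  split_ifs <;> simp_all

lemma blk_P (hI : IsInv n s I) {a c d : ℕ} (hac : Asc n s I a c) (hcd : Asc n s I c d)
    (h0 : I c a = 0) :
    rot n (rot n I c d) a d = blk n I a c d False True True := by
  funext p q
  rw [rot]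
  simp only [hac.ES_Q hI hcd h0]
  simp only [blk, rot]
  split_ifs <;> simp_all

lemma blk_W (hI : IsInv n s I) {a c d : ℕ} (hac : Asc n s I a c) (hcd : Asc n s I c d)
    (h0 : I c a = 0) :
    rot n (rot n I a c) c d = blk n I a c d True True True := by
  have h1 := hac.1.2.1
  have h2 := hcd.1.2.1
  have hE : ∀ x, ES n (rot n I a c) c x ↔ ES n I c x ∨ ES n I a x := by
    intro x
    have hA : Anc n (rot n I a c) x c ↔ Anc n I x c := by
      unfold Anc
      refine and_congr_right fun _ => and_congr_right fun _ => and_congr_right fun _ =>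
        forall_congr' fun z => forall_congr' fun hz => ?_
      rw [rot_ne (by omega), rot_ne (by omega)]
    by_cases hx : ES n I a x
    · have : Anc n I x c := by
        rcases hx with rfl | hx
        · exact hac.1
        · exact anc_trans hx.1 hac.1
      simp only [hx, or_true, iff_true]
      right
      rw [hA, rot_mem hx]
      exact ⟨this, by omega⟩
    · simp only [hx, or_false]
      unfold ES
      rw [hA, rot_not_mem hx]
  have hdis := fun x => ES.disj (n := n) (I := I) (x := x) h1 h0
  funext p q
  rw [rot]
  simp only [hE]
  have := hdis q
  simp only [blk, rot]
  by_cases hp : p = c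
  · subst hp
    have : p ≠ d := by omega
    simp [this]
    split_ifs <;> rfl
  · by_cases e1 : ES n I a q
    · have := hdis q e1
      simp [hp, e1, this]
      split_ifs <;> rfl
    · simp [hp, e1]
      split_ifs <;> rfl

lemma Asc.ES_P (hI : IsInv n s I) {a c d x : ℕ} (hac : Asc n s I a c) (hcd : Asc n s I c d)
    (h0 : I c a = 0) (hs : 2 ≤ s c) (hx : x < a) :
    Anc n (blk n I a c d False True True) x a → Anc n I x a ∧ 0 < I a x := by
  have h1 := hac.1.2.1
  have h2 := hcd.1.2.1
  intro hA
  by_contra hcon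
  have hxa : ¬ ES n I a x := by
    rintro (h | h)
    · omega
    · exact hcon h
  have haE : ES n I a a := Or.inl rfl
  have haE' : ¬ ES n I c a := ES.disj h1 h0 haE
  have e1 := hA.2.2.2 c h1
  have e2 := hA.2.2.2 d (by omega)
  have hcd' : c ≠ d := by omega
  simp only [blk, hcd', hxa, haE, haE', false_and, and_false, if_false, and_true,
    if_true, and_self, add_zero] at e1 e2
  have hxc : ¬ ES n I c x := by
    rintro (h | ⟨-, h⟩) <;> omega
  simp only [hxc, and_false, if_false] at e2
  have := hac.1.2.2.2 d h2
  have := hI.pl x c d (by omega) h2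
  omega

lemma Asc.ES_P_iff (hI : IsInv n s I) {a c d x : ℕ} (hac : Asc n s I a c)
    (hcd : Asc n s I c d) (h0 : I c a = 0) (hs : 2 ≤ s c) :
    ES n (blk n I a c d False True True) a x ↔ ES n I a x := by
  have h1 := hac.1.2.1
  have h2 := hcd.1.2.1
  constructor
  · rintro (h | h)
    · exact Or.inl h
    · exact Or.inr (hac.ES_P hI hcd h0 hs h.1.2.1 h.1)
  · rintro (h | h)
    · exact Or.inl h
    · have hxE : ES n I a x := Or.inr h
      have hxE' : ¬ ES n I c x := ES.disj h1 h0 hxE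
      have haE : ES n I a a := Or.inl rfl
      have haE' : ¬ ES n I c a := ES.disj h1 h0 haE
      right
      refine ⟨⟨h.1.1, h.1.2.1, h.1.2.2.1, fun z hz => ?_⟩, ?_⟩
      · simp [blk, hxE, hxE', haE, haE', h.1.2.2.2 z hz]
      · have := h.2
        simp only [blk]
        omega

lemma Asc.ascP (hI : IsInv n s I) {a c d : ℕ} (hac : Asc n s I a c) (hcd : Asc n s I c d)
    (h0 : I c a = 0) (hs : 2 ≤ s c) : Asc n s (blk n I a c d False True True) a c := by
  have h1 := hac.1.2.1
  have h2 := hcd.1.2.1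
  have haE : ES n I a a := Or.inl rfl
  have haE' : ¬ ES n I c a := ES.disj h1 h0 haE
  have hcE : ES n I c c := Or.inl rfl
  have hcE' : ¬ ES n I a c := fun h => by have := h.le; omega
  have hcd' : c ≠ d := by omega
  refine ⟨⟨hac.1.1, hac.1.2.1, hac.1.2.2.1, fun z hz => ?_⟩, ?_, fun e he1 he2 hA => ?_,
    fun hs0 x hx hxe => ?_⟩
  · simp [blk, haE, haE', hcE, hcE', hac.1.2.2.2 z hz]
  · simp [blk, hcd', h0]
    omega
  · exfalso
    have heE : ¬ ES n I a e := fun h => by have := h.le; omega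
    have e1 := hA.2.2.2 c he2
    have e2 := hA.2.2.2 d (by omega)
    simp only [blk, hcd', heE, haE, haE', false_and, and_false, if_false, and_true,
      if_true, and_self, add_zero] at e1 e2
    have hec : ¬ ES n I c e := by
      rintro (h | ⟨-, h⟩) <;> omega
    simp only [hec, and_false, if_false] at e2
    have := hac.1.2.2.2 d h2
    have := hI.pl e c d (by omega) h2
    omega
  · have hx' := hac.ES_P hI hcd h0 hs hx.2.1 hx
    have e1 : a ≠ c := by omega
    have e2 : a ≠ d := by omega
    simp only [blk, e1, e2, false_and, if_false, add_zero] at hxe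
    exact hac.2.2.2 hs0 x hx'.1 hxe

lemma blk_PW (hI : IsInv n s I) {a c d : ℕ} (hac : Asc n s I a c) (hcd : Asc n s I c d)
    (h0 : I c a = 0) (hs : 2 ≤ s c) :
    rot n (blk n I a c d False True True) a c = blk n I a c d True True True := by
  have h1 := hcd.1.2.1
  funext p q
  rw [rot]
  simp only [hac.ES_P_iff hI hcd h0 hs]
  simp only [blk]
  by_cases hp : p = c
  · subst hp
    have : p ≠ d := by omega
    simp [this]
    split_ifs <;> rfl
  · simp [hp]

/-- The five inversion sets of the interval. -/
lemma interval_cases' (hI : IsInv n s I) {a c d : ℕ} (hac : Asc n s I a c)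
    (hcd : Asc n s I c d) (h0 : I c a = 0) (hs : 2 ≤ s c) {U : ℕ → ℕ → ℕ} (hU : IsInv n s U)
    (hIU : ∀ y x, I y x ≤ U y x) (hUW : ∀ y x, U y x ≤ blk n I a c d True True True y x) :
    U = blk n I a c d False False False ∨ U = blk n I a c d True False False ∨
    U = blk n I a c d False True False ∨ U = blk n I a c d False True True ∨
    U = blk n I a c d True True True := by
  have h1 := hac.1.2.1
  have h2 := hcd.1.2.1
  have hcd' : c ≠ d := by omega
  have haE : ES n I a a := Or.inl rfl
  have haE' : ¬ ES n I c a := ES.disj h1 h0 haE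
  have hcE : ES n I c c := Or.inl rfl
  have hcE' : ¬ ES n I a c := fun h => by have := h.le; omega
  have hdis := fun x => ES.disj (n := n) (I := I) (x := x) h1 h0
  -- unchanged entries
  have U0 : ∀ y x, y ≠ c → y ≠ d → U y x = I y x := by
    intro y x hy1 hy2
    have := hUW y x
    simp only [blk, hy1, hy2, false_and, if_false] at this
    have := hIU y x
    omega
  have Uc0 : ∀ x, ¬ ES n I a x → U c x = I c x := by
    intro x hx
    have := hUW c x
    simp only [blk, hx, hcd', false_and, and_false, if_false] at this
    have := hIU c x
    omega
  have Ud0 : ∀ x, ¬ ES n I a x → ¬ ES n I c x → U d x = I d x := by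
    intro x hx hx'
    have := hUW d x
    simp only [blk, hx, hx', false_and, and_false, if_false] at this
    have := hIU d x
    omega
  -- blocks are moved simultaneously
  have Ua : ∀ x z, ES n I a x → a < z → U z x = U z a := by
    intro x z hx hz
    rcases hx with rfl | ⟨hA, hpos⟩
    · rfl
    · have e := U0 a x (by omega) (by omega)
      have t := hU.tr x a z hA.2.1 hz
      have p := hU.pl x a z hA.2.1 hz
      have l := hI.le a x
      have := hac.2.2.2 (by omega) x hA
      omega
  have Uc : ∀ x z, ES n I c x → c < z → U z x = U z c := by
    intro x z hx hz
    have hxa : ¬ ES n I a x := fun h => hdis x h hx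
    rcases hx with rfl | ⟨hA, hpos⟩
    · rfl
    · have e := Uc0 x hxa
      have t := hU.tr x c z hA.2.1 hz
      have p := hU.pl x c z hA.2.1 hz
      have l := hI.le c x
      have := hcd.2.2.2 (by omega) x hA
      omega
  have key : U = blk n I a c d (U c a = I c a + 1) (U d c = I d c + 1) (U d a = I d a + 1) := by
    funext y x
    by_cases hy : y = c
    · subst hy
      by_cases hx : ES n I a x
      · have := hx.eq h1
        have := Ua x y hx h1
        have w := hUW y a
        have := hIU y a
        simp only [blk, hcd', haE, haE', false_and, and_false, if_false, and_true,
          if_true, and_self, add_zero] at w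
        simp only [blk, hcd', hx, false_and, if_false, true_and, add_zero]
        split_ifs <;> omega
      · rw [Uc0 x hx]
        simp [blk, hx, hcd']
    · by_cases hy' : y = d
      · subst hy'
        by_cases hx : ES n I a x
        · have hx' := hdis x hx
          have := hx.eq (by omega : a < y)
          have := Ua x y hx (by omega)
          have w := hUW y a
          have := hIU y a
          simp only [blk, hy, haE, haE', false_and, and_false, if_false, and_true,
            if_true, and_self, add_zero] at w
          simp only [blk, hy, hx, hx', false_and, and_false, if_false, true_and, add_zero]
          split_ifs <;> omega
        · by_cases hx' : ES n I c x
          · have := hx'.eq h2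
            have := Uc x y hx' h2
            have w := hUW y c
            have := hIU y c
            simp only [blk, hy, hcE, hcE', false_and, and_false, if_false, and_true,
              if_true, and_self, add_zero] at w
            simp only [blk, hy, hx, hx', false_and, and_false, if_false, true_and, add_zero]
            split_ifs <;> omega
          · rw [Ud0 x hx hx']
            simp [blk, hx, hx']
      · rw [U0 y x hy hy']
        simp [blk, hy, hy']
  have t := hU.tr a c d h1 h2
  have p := hU.pl a c d h1 h2
  have wc := hUW c a
  simp only [blk, hcd', haE, haE', false_and, and_false, if_false, and_true,
    if_true, and_self, add_zero] at wc
  have wd := hUW d a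
  simp only [blk, hcd'.symm, haE, haE', false_and, and_false, if_false, and_true,
    if_true, and_self, add_zero] at wd
  have wd' := hUW d c
  simp only [blk, hcd'.symm, hcE, hcE', false_and, and_false, if_false, and_true,
    if_true, and_self, add_zero] at wd'
  have lc := hIU c a
  have ld := hIU d a
  have ld' := hIU d c
  have hda := hac.1.2.2.2 d h2
  by_cases q1 : U c a = I c a + 1 <;> by_cases q2 : U d c = I d c + 1 <;>
    by_cases q3 : U d a = I d a + 1 <;> simp only [q1, q2, q3] at key
  · simp only [key, true_or, or_true]
  · omega
  · omega
  · exact Or.inr (Or.inl key)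
  · exact Or.inr (Or.inr (Or.inr (Or.inl key)))
  · exact Or.inr (Or.inr (Or.inl key))
  · omega
  · exact Or.inl key

lemma blk_mono {a c d : ℕ} {x y v x' y' v' : Prop} (h1 : x → x') (h2 : y → y') (h3 : v → v')
    (p q : ℕ) : blk n I a c d x y v p q ≤ blk n I a c d x' y' v' p q := by
  unfold blk
  gcongr <;> (split_ifs <;> first | omega | tauto)

lemma blk_le_iff {a c d : ℕ} (hac : a < c) (hcd : c < d) (h0 : I c a = 0)
    {x y v x' y' v' : Prop} :
    (∀ p q, blk n I a c d x y v p q ≤ blk n I a c d x' y' v' p q) ↔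
      (x → x') ∧ (y → y') ∧ (v → v') := by
  have haE : ES n I a a := Or.inl rfl
  have haE' : ¬ ES n I c a := ES.disj hac h0 haE
  have hcE : ES n I c c := Or.inl rfl
  have hcE' : ¬ ES n I a c := fun h => by have := h.le; omega
  have hcd' : c ≠ d := by omega
  constructor
  · intro h
    refine ⟨fun hx => ?_, fun hx => ?_, fun hx => ?_⟩
    · by_contra hx'
      have := h c a
      simp [blk, hcd', haE, haE', hx, hx'] at this
    · by_contra hx'
      have := h d c
      simp [blk, hcd'.symm, hcE, hcE', hx, hx'] at this
    · by_contra hx'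
      have := h d a
      simp [blk, hcd'.symm, haE, haE', hx, hx'] at this
  · rintro ⟨h1, h2, h3⟩
    exact blk_mono h1 h2 h3

end Pentagon

/-- the second pentagon case.  If `(c,d)` is a tree ascent of `Z` but
`(a,b)` is not a tree ascent of `Q`, then `[T, Z ∨ Q] = {T, Z, Q, P, Z ∨ Q}` is a
pentagon with the two maximal chains `T ⋖ Z ⋖ Z ∨ Q` (labels `a, c`) and
`T ⋖ Q ⋖ P ⋖ Z ∨ Q` (labels `c, a, a`), the labels being the smaller elements of the
ascents along which the rotations are performed. -/
theorem pentagon_interval_second (n : ℕ) (s : ℕ → ℕ) (T Z Q W : SDecTree n s)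
    (a b c d : ℕ) (hac : a < c)
    (hZ : SDecTree.IsRotation T Z a b) (hQ : SDecTree.IsRotation T Q c d)
    (hQa : ¬ Q.TreeAscent a b) (hZc : Z.TreeAscent c d)
    (hW : SDecTree.IsJoin Z Q W) :
    ∃ P : SDecTree n s,
      {U : SDecTree n s | SDecTree.wle T U ∧ SDecTree.wle U W} = {T, Z, Q, P, W} ∧
      (T ≠ Z ∧ T ≠ Q ∧ T ≠ P ∧ T ≠ W ∧ Z ≠ Q ∧ Z ≠ P ∧ Z ≠ W ∧ Q ≠ P ∧ Q ≠ W ∧ P ≠ W) ∧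
      SDecTree.wcov T Z ∧ SDecTree.wcov Z W ∧
      SDecTree.wcov T Q ∧ SDecTree.wcov Q P ∧ SDecTree.wcov P W ∧
      SDecTree.IsRotation Z W c d ∧ SDecTree.IsRotation Q P a d ∧
      SDecTree.IsRotation P W a c := by
  rw [SDecTree.isRotation_iff] at hZ hQ
  rw [SDecTree.treeAscent_iff] at hQa hZc
  obtain ⟨hab, hZ⟩ := hZ
  obtain ⟨hcd, hQ⟩ := hQ
  have hI := T.card_isInv
  rw [hQ] at hQa
  rw [hZ] at hZc
  have hb : b = c ∧ T.card c a = 0 := by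
    by_contra hbc
    exact hQa (hab.forced hI hcd hac hbc)
  obtain ⟨rfl, h0⟩ := hb
  have hs := hab.two_le hI h0 hZc
  have hbd := hcd.1.2.1
  have ascQ := hab.ascQ hI hcd h0
  obtain ⟨P, hP⟩ := (ascQ.isInv_rot (hcd.isInv_rot hI)).exists_tree
  obtain ⟨W', hW'⟩ := (hZc.isInv_rot (hab.isInv_rot hI)).exists_tree
  have bT := blk_T (n := n) (I := T.card) (a := a) (c := b) (d := d)
  have bZ := hZ.trans (blk_Z (d := d))
  have bQ := hQ.trans (blk_Q (a := a))
  have bP := hP.trans (blk_P hI hab hcd h0)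
  have bW' := hW'.trans (blk_W hI hab hcd h0)
  have ble := fun x y v x' y' v' => blk_le_iff (n := n) (I := T.card) (x := x) (y := y)
    (v := v) (x' := x') (y' := y') (v' := v') hac hbd h0
  -- the join is the rotation of `Z` along `(c,d)`
  have hWW : W = W' := by
    apply SDecTree.eq_of_card_eq
    have l1 : SDecTree.wle W W' := by
      apply hW.2.2
      · unfold SDecTree.wle
        rw [bZ, bW', ble]
        tauto
      · unfold SDecTree.wle
        rw [bQ, bW', ble]
        tauto
    have l2 : SDecTree.wle W' W := by
      intro y x
      rw [hW']
      refine hZc.rot_le (hab.isInv_rot hI) W.card_isInv.tr (fun y x => ?_) ?_ y x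
      · rw [← hZ]
        exact hW.1 y x
      · have := hW.2.1 d b
        rw [hQ, rot_mem (Or.inl rfl)] at this
        rw [rot_ne (by omega)]
        exact this
    funext y x
    exact le_antisymm (l1 y x) (l2 y x)
  subst hWW
  -- order relations between trees of the interval
  have cmp : ∀ (U V : SDecTree n s) (x y v x' y' v' : Prop),
      U.card = blk n T.card a b d x y v → V.card = blk n T.card a b d x' y' v' →
      (SDecTree.wle U V ↔ (x → x') ∧ (y → y') ∧ (v → v')) := by
    intro U V x y v x' y' v' h1 h2
    unfold SDecTree.wle
    rw [h1, h2, ble]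
  have five : ∀ U : SDecTree n s, SDecTree.wle T U → SDecTree.wle U W →
      U = T ∨ U = Z ∨ U = Q ∨ U = P ∨ U = W := by
    intro U h1 h2
    have h2' : ∀ y x, U.card y x ≤ blk n T.card a b d True True True y x := by
      rw [← bW']
      exact h2
    rcases interval_cases' hI hab hcd h0 hs U.card_isInv h1 h2' with h | h | h | h | h
    · exact Or.inl (SDecTree.eq_of_card_eq (h.trans bT.symm))
    · exact Or.inr (Or.inl (SDecTree.eq_of_card_eq (h.trans bZ.symm)))
    · exact Or.inr (Or.inr (Or.inl (SDecTree.eq_of_card_eq (h.trans bQ.symm))))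
    · exact Or.inr (Or.inr (Or.inr (Or.inl (SDecTree.eq_of_card_eq (h.trans bP.symm)))))
    · exact Or.inr (Or.inr (Or.inr (Or.inr (SDecTree.eq_of_card_eq (h.trans bW'.symm)))))
  have wtrans : ∀ U V X : SDecTree n s, SDecTree.wle U V → SDecTree.wle V X →
      SDecTree.wle U X := fun U V X h1 h2 y x => (h1 y x).trans (h2 y x)
  have TZ := cmp _ _ _ _ _ _ _ _ bT bZ
  have ZT := cmp _ _ _ _ _ _ _ _ bZ bT
  have TQ := cmp _ _ _ _ _ _ _ _ bT bQ
  have QT := cmp _ _ _ _ _ _ _ _ bQ bT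
  have TP := cmp _ _ _ _ _ _ _ _ bT bP
  have PT := cmp _ _ _ _ _ _ _ _ bP bT
  have TW := cmp _ _ _ _ _ _ _ _ bT bW'
  have WT := cmp _ _ _ _ _ _ _ _ bW' bT
  have ZQ := cmp _ _ _ _ _ _ _ _ bZ bQ
  have QZ := cmp _ _ _ _ _ _ _ _ bQ bZ
  have ZP := cmp _ _ _ _ _ _ _ _ bZ bP
  have PZ := cmp _ _ _ _ _ _ _ _ bP bZ
  have ZW := cmp _ _ _ _ _ _ _ _ bZ bW'
  have WZ := cmp _ _ _ _ _ _ _ _ bW' bZ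
  have QP := cmp _ _ _ _ _ _ _ _ bQ bP
  have PQ := cmp _ _ _ _ _ _ _ _ bP bQ
  have QW := cmp _ _ _ _ _ _ _ _ bQ bW'
  have WQ := cmp _ _ _ _ _ _ _ _ bW' bQ
  have PW := cmp _ _ _ _ _ _ _ _ bP bW'
  have WP := cmp _ _ _ _ _ _ _ _ bW' bP
  have rT := cmp _ _ _ _ _ _ _ _ bT bT
  have rW := cmp _ _ _ _ _ _ _ _ bW' bW'
  simp only [forall_const, and_self, imp_self, and_true, true_and, not_true_eq_false, iff_true,
    iff_false, imp_false, implies_true, and_false, false_and] at TZ ZT TQ QT TP PT TW WT ZQ QZ ZP PZ ZW WZ QP PQ QW WQ PW WP rT rW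
  have nene : ∀ U V : SDecTree n s, SDecTree.wle U U → ¬ SDecTree.wle V U → U ≠ V := by
    rintro U V h1 h2 rfl
    exact h2 h1
  have rfl' : ∀ U : SDecTree n s, SDecTree.wle U U := fun U y x => le_rfl
  have cov : ∀ U V : SDecTree n s, SDecTree.wle T U → SDecTree.wle V W → SDecTree.wle U V →
      ¬ SDecTree.wle V U →
      (∀ X, X = T ∨ X = Z ∨ X = Q ∨ X = P ∨ X = W → SDecTree.wle U X → ¬ SDecTree.wle X U →
        SDecTree.wle X V → ¬ SDecTree.wle V X → False) → SDecTree.wcov U V := by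
    intro U V h1 h2 h3 h4 h5
    refine ⟨⟨h3, h4⟩, fun X hX1 hX2 => ?_⟩
    exact h5 X (five X (wtrans _ _ _ h1 hX1.1) (wtrans _ _ _ hX2.1 h2)) hX1.1 hX1.2 hX2.1 hX2.2
  refine ⟨P, ?_, ⟨nene _ _ (rfl' _) ZT, nene _ _ (rfl' _) QT, nene _ _ (rfl' _) PT,
    nene _ _ (rfl' _) WT, nene _ _ (rfl' _) QZ, nene _ _ (rfl' _) PZ, nene _ _ (rfl' _) WZ,
    nene _ _ (rfl' _) PQ, nene _ _ (rfl' _) WQ, nene _ _ (rfl' _) WP⟩,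
    ?_, ?_, ?_, ?_, ?_, ?_, ?_, ?_⟩
  · ext U
    simp only [Set.mem_setOf_eq, Set.mem_insert_iff, Set.mem_singleton_iff]
    constructor
    · rintro ⟨h1, h2⟩
      exact five U h1 h2
    · rintro (rfl | rfl | rfl | rfl | rfl)
      · exact ⟨rT, TW⟩
      · exact ⟨TZ, ZW⟩
      · exact ⟨TQ, QW⟩
      · exact ⟨TP, PW⟩
      · exact ⟨TW, rW⟩
  · apply cov _ _ rT ZW TZ ZT
    rintro X (h | h | h | h | h) h1 h2 h3 h4 <;> rw [h] at h1 h2 h3 h4 <;> tauto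
  · apply cov _ _ TZ rW ZW WZ
    rintro X (h | h | h | h | h) h1 h2 h3 h4 <;> rw [h] at h1 h2 h3 h4 <;> tauto
  · apply cov _ _ rT QW TQ QT
    rintro X (h | h | h | h | h) h1 h2 h3 h4 <;> rw [h] at h1 h2 h3 h4 <;> tauto
  · apply cov _ _ TQ PW QP PQ
    rintro X (h | h | h | h | h) h1 h2 h3 h4 <;> rw [h] at h1 h2 h3 h4 <;> tauto
  · apply cov _ _ TP rW PW WP
    rintro X (h | h | h | h | h) h1 h2 h3 h4 <;> rw [h] at h1 h2 h3 h4 <;> tauto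
  · rw [SDecTree.isRotation_iff, hZ]
    exact ⟨hZc, hW'⟩
  · rw [SDecTree.isRotation_iff, hQ]
    exact ⟨ascQ, hP⟩
  · rw [SDecTree.isRotation_iff, bP]
    exact ⟨hab.ascP hI hcd h0 hs, bW'.trans (blk_PW hI hab hcd h0 hs).symm⟩
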